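/- Let ρ ∈ [0,1), κ > 0, c > 1, and let positive sequences {σ_k}, {τ_k}, {ν_k} satisfy τ_k ≥ τ_min > 0, τ_{k+1} ≤ (1+ν_k)τ_k with ν_k ≥ 0 and Σ ν_k < ∞, √τ_min − 2√ρ > 0, and liminf_{k→∞} σ_k > c · 2κ√τ_max(ρ + √(ρ τ̄_max))/(√τ_min − 2√ρ), where τ_max := τ_0 ∏_{k=0}^∞ (1+ν_k) and τ̄_max := max{1, τ_max}. Define τ̄_k := max{1, τ_k} and γ_k := (1 − (2κ√τ_k(ρ + √(ρ τ̄_k)) + 2σ_k√ρ)/(σ_k √τ_k)) · σ_k² / (κ² (√ρ + √τ̄_k)² τ̄_k). Then for all sufficiently large k, γ_k ≥ ((c−1)/c) · ((√τ_min − 2√ρ)/√τ_min) · σ_k² / (κ² (√ρ + √τ̄_max)² τ̄_max) > 0. -/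

import Mathlib

open Filter Topology

noncomputable section

/-- A positive sequence with summable relative growth is bounded by the infinite growth product. -/
theorem le_mul_tprod_of_le_one_add_mul {τ ν : ℕ → ℝ} (hτ : 0 ≤ τ 0) (hν : ∀ k, 0 ≤ ν k)
    (hτν : ∀ k, τ (k + 1) ≤ (1 + ν k) * τ k) (hsum : Summable ν) (k : ℕ) :
    τ k ≤ τ 0 * ∏' i, (1 + ν i) := by
  have hfin : ∀ n, τ n ≤ τ 0 * ∏ i ∈ Finset.range n, (1 + ν i) := by
    intro n
    induction n with
    | zero => simp
    | succ n ih =>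
      calc τ (n + 1) ≤ (1 + ν n) * τ n := hτν n
        _ ≤ (1 + ν n) * (τ 0 * ∏ i ∈ Finset.range n, (1 + ν i)) :=
          mul_le_mul_of_nonneg_left ih (by linarith [hν n])
        _ = τ 0 * ∏ i ∈ Finset.range (n + 1), (1 + ν i) := by
          rw [Finset.prod_range_succ]; ring
  have hmono : Monotone fun n => ∏ i ∈ Finset.range n, (1 + ν i) := by
    refine monotone_nat_of_le_succ fun n => ?_
    rw [Finset.prod_range_succ]
    exact le_mul_of_one_le_right (Finset.prod_nonneg fun i _ => by linarith [hν i])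
      (by linarith [hν n])
  have hlim := (Real.multipliable_one_add_of_summable hsum).hasProd.tendsto_prod_nat
  exact (hfin k).trans (mul_le_mul_of_nonneg_left (hmono.ge_of_tendsto hlim k) hτ)

/-- Lower bound for the numerator factor when `σ` exceeds its threshold;
here `r = √ρ`, `m = √τmin`, `t = √τ`, `M = √τmax`. -/
theorem one_sub_div_ge_of_threshold {κ c r m t M X Y σ : ℝ} (hκ : 0 < κ) (hc : 1 < c)
    (hr : 0 ≤ r) (hm : 0 < m) (hmt : m ≤ t) (hmM : m ≤ M) (hd : 0 < m - 2 * r)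
    (hσ : 0 < σ) (hXY : X ≤ Y) (hY : 0 ≤ Y)
    (h : c * (2 * κ * M * Y / (m - 2 * r)) ≤ σ) :
    (c - 1) / c * ((m - 2 * r) / m) ≤ 1 - (2 * κ * t * X + 2 * σ * r) / (σ * t) := by
  have ht : 0 < t := hm.trans_le hmt
  have hc0 : 0 < c := by linarith
  have hsplit : (2 * κ * t * X + 2 * σ * r) / (σ * t) = 2 * κ * X / σ + 2 * r / t := by
    field_simp
  have hrt : 2 * r / t ≤ 2 * r / m := by gcongr
  have hX : 2 * κ * X / σ ≤ (m - 2 * r) / (c * m) := by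
    rw [← mul_div_assoc, div_le_iff₀ hd] at h
    rw [div_le_div_iff₀ hσ (by positivity)]
    calc 2 * κ * X * (c * m) ≤ 2 * κ * Y * (c * M) := by gcongr
      _ = c * (2 * κ * M * Y) := by ring
      _ ≤ σ * (m - 2 * r) := h
      _ = (m - 2 * r) * σ := mul_comm _ _
  have hid : (c - 1) / c * ((m - 2 * r) / m) = 1 - ((m - 2 * r) / (c * m) + 2 * r / m) := by
    field_simp
    ring
  rw [hsplit, hid]
  linarith

theorem gamma_eventually_bounded_below
    (ρ κ c τmin : ℝ) (σ τ ν γ : ℕ → ℝ)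
    (hρ0 : 0 ≤ ρ) (hρ1 : ρ < 1) (hκ : 0 < κ) (hc : 1 < c)
    (hσpos : ∀ k, 0 < σ k) (hτpos : ∀ k, 0 < τ k)
    (hτmin : 0 < τmin) (hτ : ∀ k, τmin ≤ τ k)
    (hν : ∀ k, 0 ≤ ν k) (hτν : ∀ k, τ (k + 1) ≤ (1 + ν k) * τ k) (hνsum : Summable ν)
    (τmax τbmax : ℝ)
    (hτmax : τmax = τ 0 * ∏' k, (1 + ν k)) (hτbmax : τbmax = max 1 τmax)
    (hpc1 : 0 < Real.sqrt τmin - 2 * Real.sqrt ρ)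
    -- liminf σ_k > c · 2κ√τmax(ρ + √(ρ τ̄max)) / (√τmin − 2√ρ)
    (hpc2 : ∃ s : ℝ, c * (2 * κ * Real.sqrt τmax * (ρ + Real.sqrt (ρ * τbmax))
        / (Real.sqrt τmin - 2 * Real.sqrt ρ)) < s ∧ ∀ᶠ k in atTop, s ≤ σ k)
    (hγ : ∀ k, γ k = (1 - (2 * κ * Real.sqrt (τ k) * (ρ + Real.sqrt (ρ * max 1 (τ k)))
          + 2 * σ k * Real.sqrt ρ) / (σ k * Real.sqrt (τ k)))
        * (σ k) ^ 2 / (κ ^ 2 * (Real.sqrt ρ + Real.sqrt (max 1 (τ k))) ^ 2 * max 1 (τ k))) :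
    ∀ᶠ k in atTop,
      0 < (c - 1) / c * ((Real.sqrt τmin - 2 * Real.sqrt ρ) / Real.sqrt τmin)
            * (σ k) ^ 2 / (κ ^ 2 * (Real.sqrt ρ + Real.sqrt τbmax) ^ 2 * τbmax)
      ∧ (c - 1) / c * ((Real.sqrt τmin - 2 * Real.sqrt ρ) / Real.sqrt τmin)
            * (σ k) ^ 2 / (κ ^ 2 * (Real.sqrt ρ + Real.sqrt τbmax) ^ 2 * τbmax) ≤ γ k := by
  obtain ⟨s, hs, hsσ⟩ := hpc2
  filter_upwards [hsσ] with k hk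
  have hle : τ k ≤ τmax := hτmax ▸ le_mul_tprod_of_le_one_add_mul (hτpos 0).le hν hτν hνsum k
  have hb : max 1 (τ k) ≤ τbmax := hτbmax ▸ max_le_max le_rfl hle
  have hone : (1 : ℝ) ≤ max 1 (τ k) := le_max_left _ _
  have hσ := hσpos k
  have hm : 0 < Real.sqrt τmin := Real.sqrt_pos.2 hτmin
  have hsb : 0 < Real.sqrt (max 1 (τ k)) := Real.sqrt_pos.2 (by linarith)
  have hsb' : Real.sqrt (max 1 (τ k)) ≤ Real.sqrt τbmax := Real.sqrt_le_sqrt hb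
  have hb0 : 0 < τbmax := by linarith
  have hr : 0 ≤ Real.sqrt ρ := Real.sqrt_nonneg ρ
  have hcoef : 0 < (c - 1) / c * ((Real.sqrt τmin - 2 * Real.sqrt ρ) / Real.sqrt τmin) :=
    mul_pos (div_pos (by linarith) (by linarith)) (div_pos hpc1 hm)
  have hsum : 0 < Real.sqrt ρ + Real.sqrt τbmax := by linarith
  refine ⟨by positivity, ?_⟩
  have hfac := one_sub_div_ge_of_threshold (t := Real.sqrt (τ k)) hκ hc hr hm
    (Real.sqrt_le_sqrt (hτ k)) (Real.sqrt_le_sqrt ((hτ k).trans hle)) hpc1 hσ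
    (X := ρ + Real.sqrt (ρ * max 1 (τ k))) (by gcongr) (by positivity) (hs.le.trans hk)
  rw [hγ k]
  have hnonneg := hcoef.le.trans hfac
  gcongr
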